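/- arXiv:2501.06739 — 5 statements merged into one kernel-verified Lean document; each statement's English description precedes it below -/
import Mathlib

section
/- Let (X, b, s) be a complete b-metric space with coefficient s ≥ 1 and let S : X → X be a J_{A_R}-contraction, i.e. there exist a function J : [1,∞) × [1,∞) → ℝ which is an A_R-simulation function whose sequence condition holds with the same coefficient s (with associated function F ∈ 𝔉_c having constant c ≥ 1 and function ϑ ∈ Θ*), such that J(ϑ(b(Sx,Sy)), ϑ(b(x,y))) ≥ c for all x, y ∈ X with b(Sx,Sy) > 0. Then S has a unique fixed point in X. -/
open Filter Topology

/-- A b-metric on `X` with coefficient `s`. -/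
def IsBMetric {X : Type*} (b : X → X → ℝ) (s : ℝ) : Prop :=
  (∀ x y, 0 ≤ b x y) ∧
  (∀ x y, b x y = 0 ↔ x = y) ∧
  (∀ x y, b x y = b y x) ∧
  (∀ x y z, b x z ≤ s * (b x y + b y z))

/-- A sequence is Cauchy with respect to a b-metric. -/
def BCauchy {X : Type*} (b : X → X → ℝ) (u : ℕ → X) : Prop :=
  ∀ ε > (0 : ℝ), ∃ N : ℕ, ∀ k ≥ N, ∀ m ≥ N, b (u k) (u m) < ε

/-- Completeness of a b-metric space: every Cauchy sequence converges. -/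
def BComplete {X : Type*} (b : X → X → ℝ) : Prop :=
  ∀ u : ℕ → X, BCauchy b u → ∃ z : X, Tendsto (fun n => b (u n) z) atTop (𝓝 0)

/-- `S` is b-continuous: it preserves convergence of sequences. -/
def BContinuousMap {X : Type*} (b : X → X → ℝ) (S : X → X) : Prop :=
  ∀ (u : ℕ → X) (x : X), Tendsto (fun n => b (u n) x) atTop (𝓝 0) →
    Tendsto (fun n => b (S (u n)) (S x)) atTop (𝓝 0)

/-- The class `Θ*` of auxiliary functions `ϑ : (0,∞) → (1,∞)`:
increasing, continuous, and `ϑ(aₙ) → 1` iff `aₙ → 0`. -/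
def ThetaStar (ϑ : ℝ → ℝ) : Prop :=
  (∀ x, 0 < x → 1 < ϑ x) ∧
  MonotoneOn ϑ (Set.Ioi 0) ∧
  ContinuousOn ϑ (Set.Ioi 0) ∧
  ∀ u : ℕ → ℝ, (∀ n, 0 < u n) →
    (Tendsto (fun n => ϑ (u n)) atTop (𝓝 1) ↔ Tendsto u atTop (𝓝 0))

/-- The class `𝔉_c` of functions `F : [1,∞) × [1,∞) → ℝ` with constant `c ≥ 1`. -/
def FcClass (F : ℝ → ℝ → ℝ) (c : ℝ) : Prop :=
  ContinuousOn (fun p : ℝ × ℝ => F p.1 p.2) (Set.Ici 1 ×ˢ Set.Ici 1) ∧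
  (∀ x y, 1 ≤ x → 1 ≤ y → F x y ≤ x) ∧
  (∀ x y, 1 ≤ x → 1 ≤ y → F x y = x → x = 1 ∨ y = 1) ∧
  1 ≤ c ∧
  (∀ x y, 1 ≤ x → 1 ≤ y → c < F x y → y < x) ∧
  (∀ x, 1 ≤ x → F x x ≤ c)

/-- The condition on a pair of positive sequences appearing in the definition of an
`A_R`-simulation function with coefficient `s`:
`0 < liminf uₙ ≤ s·limsup vₙ ≤ s²·liminf uₙ < ∞` and
`0 < liminf vₙ ≤ s·limsup uₙ ≤ s²·liminf vₙ < ∞` (computed in the extended reals). -/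
def SeqCond (s : ℝ) (u v : ℕ → ℝ) : Prop :=
  (0 < Filter.liminf (fun n => ((u n : EReal))) atTop ∧
    Filter.liminf (fun n => ((u n : EReal))) atTop ≤
      (s : EReal) * Filter.limsup (fun n => ((v n : EReal))) atTop ∧
    (s : EReal) * Filter.limsup (fun n => ((v n : EReal))) atTop ≤
      ((s ^ 2 : ℝ) : EReal) * Filter.liminf (fun n => ((u n : EReal))) atTop ∧
    ((s ^ 2 : ℝ) : EReal) * Filter.liminf (fun n => ((u n : EReal))) atTop < ⊤) ∧
  (0 < Filter.liminf (fun n => ((v n : EReal))) atTop ∧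
    Filter.liminf (fun n => ((v n : EReal))) atTop ≤
      (s : EReal) * Filter.limsup (fun n => ((u n : EReal))) atTop ∧
    (s : EReal) * Filter.limsup (fun n => ((u n : EReal))) atTop ≤
      ((s ^ 2 : ℝ) : EReal) * Filter.liminf (fun n => ((v n : EReal))) atTop ∧
    ((s ^ 2 : ℝ) : EReal) * Filter.liminf (fun n => ((v n : EReal))) atTop < ⊤)

/-- `J` is an `A_R`-simulation function with data `s`, `F ∈ 𝔉_c` (constant `c`), `ϑ ∈ Θ*`. -/
def ARSimulation (J : ℝ → ℝ → ℝ) (s : ℝ) (F : ℝ → ℝ → ℝ) (c : ℝ) (ϑ : ℝ → ℝ) : Prop :=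
  (∀ x y : ℝ, 1 < x → 1 < y → J x y < F y x) ∧
  ∀ u v : ℕ → ℝ, (∀ n, 0 < u n) → (∀ n, 0 < v n) → SeqCond s u v →
    Filter.limsup (fun n => J (ϑ (u n)) (ϑ (v n))) atTop < c

/-- Positive sequences with values in `[ε, s (ε + δ n)]`, `δ n → 0`, satisfy `SeqCond s`. -/
theorem seqCond_of_bounds {s ε : ℝ} (hs : 1 ≤ s) (hε : 0 < ε) {u v δ : ℕ → ℝ}
    (hδ : Tendsto δ atTop (𝓝 0)) (hu : ∀ n, ε ≤ u n) (hv : ∀ n, ε ≤ v n)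
    (hu' : ∀ n, u n ≤ s * (ε + δ n)) (hv' : ∀ n, v n ≤ s * (ε + δ n)) : SeqCond s u v := by
  have key : ∀ w : ℕ → ℝ, (∀ n, ε ≤ w n) → (∀ n, w n ≤ s * (ε + δ n)) →
      ∃ l L : ℝ, liminf (fun n => (w n : EReal)) atTop = l ∧
        limsup (fun n => (w n : EReal)) atTop = L ∧ ε ≤ l ∧ l ≤ L ∧ L ≤ s * ε := by
    intro w hw hw'
    have hlim : Tendsto (fun n => ((s * (ε + δ n) : ℝ) : EReal)) atTop (𝓝 ((s * ε : ℝ) : EReal)) := by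
      have h : Tendsto (fun n => s * (ε + δ n)) atTop (𝓝 (s * (ε + 0))) :=
        (hδ.const_add ε).const_mul s
      rw [add_zero] at h
      exact (continuous_coe_real_ereal.tendsto _).comp h
    have h1 : (ε : EReal) ≤ liminf (fun n => (w n : EReal)) atTop :=
      le_liminf_of_le (h := Eventually.of_forall fun n => EReal.coe_le_coe_iff.2 (hw n))
    have h2 : liminf (fun n => (w n : EReal)) atTop ≤ limsup (fun n => (w n : EReal)) atTop :=
      liminf_le_limsup
    have h3 : limsup (fun n => (w n : EReal)) atTop ≤ ((s * ε : ℝ) : EReal) := by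
      rw [← hlim.limsup_eq]
      exact limsup_le_limsup (Eventually.of_forall fun n => EReal.coe_le_coe_iff.2 (hw' n))
    generalize liminf (fun n => (w n : EReal)) atTop = l at *
    generalize limsup (fun n => (w n : EReal)) atTop = L at *
    have hl : l ≠ ⊤ := ((h2.trans h3).trans_lt (EReal.coe_lt_top _)).ne
    have hl' : l ≠ ⊥ := ((EReal.bot_lt_coe _).trans_le h1).ne'
    have hL : L ≠ ⊤ := (h3.trans_lt (EReal.coe_lt_top _)).ne
    have hL' : L ≠ ⊥ := ((EReal.bot_lt_coe _).trans_le (h1.trans h2)).ne'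
    lift l to ℝ using ⟨hl, hl'⟩
    lift L to ℝ using ⟨hL, hL'⟩
    exact ⟨l, L, rfl, rfl, EReal.coe_le_coe_iff.1 h1, EReal.coe_le_coe_iff.1 h2,
      EReal.coe_le_coe_iff.1 h3⟩
  obtain ⟨l, L, hl, hL, h1, h2, h3⟩ := key u hu hu'
  obtain ⟨m, M, hm, hM, k1, k2, k3⟩ := key v hv hv'
  have real_bounds : ∀ l L M : ℝ, ε ≤ l → l ≤ L → L ≤ s * ε → ε ≤ M → M ≤ s * ε →
      0 < l ∧ l ≤ s * M ∧ s * M ≤ s ^ 2 * l := by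
    intro l L M h1 h2 h3 k1 k2
    have hs0 : 0 ≤ s := zero_le_one.trans hs
    refine ⟨hε.trans_le h1, (h2.trans h3).trans (mul_le_mul_of_nonneg_left k1 hs0), ?_⟩
    calc s * M ≤ s * (s * l) :=
          mul_le_mul_of_nonneg_left (k2.trans (mul_le_mul_of_nonneg_left h1 hs0)) hs0
      _ = s ^ 2 * l := by ring
  obtain ⟨a1, a2, a3⟩ := real_bounds l L M h1 h2 h3 (k1.trans k2) k3
  obtain ⟨b1, b2, b3⟩ := real_bounds m M L k1 k2 k3 (h1.trans h2) h3
  unfold SeqCond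
  rw [hl, hL, hm, hM]
  simp only [← EReal.coe_mul, EReal.coe_le_coe_iff, EReal.coe_pos, EReal.coe_lt_top, and_true]
  exact ⟨⟨a1, a2, a3⟩, b1, b2, b3⟩

section Contraction

variable {X : Type*} {b : X → X → ℝ} {s : ℝ} {S : X → X} {J F : ℝ → ℝ → ℝ} {ϑ : ℝ → ℝ} {c : ℝ}

theorem IsBMetric.pos_of_map_pos (hb : IsBMetric b s) {x y : X} (h : 0 < b (S x) (S y)) :
    0 < b x y := by
  refine lt_of_le_of_ne (hb.1 x y) fun h0 => h.ne' ?_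
  rw [(hb.2.1 x y).1 h0.symm]
  exact (hb.2.1 _ _).2 rfl

/-- An `𝔍_{A_R}`-contraction strictly decreases nonzero distances. -/
theorem map_dist_lt (hb : IsBMetric b s) (hϑ : ThetaStar ϑ) (hF : FcClass F c)
    (hJ : ARSimulation J s F c ϑ)
    (hcontr : ∀ x y : X, 0 < b (S x) (S y) → c ≤ J (ϑ (b (S x) (S y))) (ϑ (b x y)))
    {x y : X} (h : 0 < b (S x) (S y)) : b (S x) (S y) < b x y := by
  have hxy := hb.pos_of_map_pos h
  have h1 := hϑ.1 _ h
  have h2 := hϑ.1 _ hxy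
  have h3 := hF.2.2.2.2.1 _ _ h2.le h1.le ((hcontr x y h).trans_lt (hJ.1 _ _ h1 h2))
  by_contra! hle
  exact h3.not_ge (hϑ.2.1 hxy h hle)

theorem map_dist_le (hb : IsBMetric b s) (hϑ : ThetaStar ϑ) (hF : FcClass F c)
    (hJ : ARSimulation J s F c ϑ)
    (hcontr : ∀ x y : X, 0 < b (S x) (S y) → c ≤ J (ϑ (b (S x) (S y))) (ϑ (b x y)))
    (x y : X) : b (S x) (S y) ≤ b x y := by
  rcases (hb.1 (S x) (S y)).eq_or_lt with h | h
  · exact h ▸ hb.1 x y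
  · exact (map_dist_lt hb hϑ hF hJ hcontr h).le

/-- There are no sequences of pairs whose images stay `ε` apart while the pairs themselves are
asymptotically at distance at most `s * ε`. -/
theorem not_dist_bounds (hs : 1 ≤ s) (hb : IsBMetric b s) (hϑ : ThetaStar ϑ) (hF : FcClass F c)
    (hJ : ARSimulation J s F c ϑ)
    (hcontr : ∀ x y : X, 0 < b (S x) (S y) → c ≤ J (ϑ (b (S x) (S y))) (ϑ (b x y)))
    {ε : ℝ} (hε : 0 < ε) {p q : ℕ → X} {δ : ℕ → ℝ} (hδ : Tendsto δ atTop (𝓝 0))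
    (hlow : ∀ n, ε ≤ b (S (p n)) (S (q n))) (hup : ∀ n, b (p n) (q n) ≤ s * (ε + δ n)) :
    False := by
  have hle n := map_dist_le hb hϑ hF hJ hcontr (p n) (q n)
  have hu n : 0 < b (S (p n)) (S (q n)) := hε.trans_le (hlow n)
  have hv n : 0 < b (p n) (q n) := (hu n).trans_le (hle n)
  have hlt := hJ.2 _ _ hu hv (seqCond_of_bounds hs hε hδ hlow
    (fun n => (hlow n).trans (hle n)) (fun n => (hle n).trans (hup n)) hup)
  obtain ⟨M, hM⟩ := hδ.bddAbove_range
  have hvM n : b (p n) (q n) ≤ s * (ε + M) :=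
    (hup n).trans (mul_le_mul_of_nonneg_left
      (add_le_add_right (hM (Set.mem_range_self n)) ε) (zero_le_one.trans hs))
  refine hlt.not_ge (le_limsup_of_frequently_le
    (Frequently.of_forall fun n => hcontr _ _ (hu n)) ?_)
  refine isBoundedUnder_of ⟨ϑ (s * (ε + M)), fun n => ?_⟩
  have h1 := hϑ.1 _ (hu n)
  have h2 := hϑ.1 _ (hv n)
  exact (hJ.1 _ _ h1 h2).le.trans ((hF.2.1 _ _ h2.le h1.le).trans
    (hϑ.2.1 (hv n) ((hv n).trans_le (hvM n)) (hvM n)))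

theorem tendsto_dist_iterate_succ (hs : 1 ≤ s) (hb : IsBMetric b s) (hϑ : ThetaStar ϑ)
    (hF : FcClass F c) (hJ : ARSimulation J s F c ϑ)
    (hcontr : ∀ x y : X, 0 < b (S x) (S y) → c ≤ J (ϑ (b (S x) (S y))) (ϑ (b x y)))
    (x : X) : Tendsto (fun n => b (S^[n] x) (S^[n + 1] x)) atTop (𝓝 0) := by
  have hanti : Antitone fun n => b (S^[n] x) (S^[n + 1] x) := by
    refine antitone_nat_of_succ_le fun n => ?_
    simp only [Function.iterate_succ_apply' S]
    exact map_dist_le hb hϑ hF hJ hcontr _ _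
  have hbdd : BddBelow (Set.range fun n => b (S^[n] x) (S^[n + 1] x)) :=
    ⟨0, by rintro _ ⟨n, rfl⟩; exact hb.1 _ _⟩
  have hlim := tendsto_atTop_ciInf hanti hbdd
  have hlow := ciInf_le hbdd
  have hnonneg : 0 ≤ ⨅ n, b (S^[n] x) (S^[n + 1] x) := le_ciInf fun n => hb.1 _ _
  generalize (⨅ n, b (S^[n] x) (S^[n + 1] x)) = r at *
  rcases hnonneg.eq_or_lt with h0 | hr
  · rwa [← h0] at hlim
  · have hδ : Tendsto (fun n => b (S^[n] x) (S^[n + 1] x) - r) atTop (𝓝 0) := by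
      simpa using hlim.sub_const r
    refine (not_dist_bounds hs hb hϑ hF hJ hcontr hr (p := fun n => S^[n] x)
      (q := fun n => S^[n + 1] x) hδ (fun n => ?_) fun n => ?_).elim
    · simpa only [Function.iterate_succ_apply' S] using hlow (n + 1)
    · rw [add_sub_cancel]
      exact le_mul_of_one_le_left (hb.1 _ _) hs

theorem bCauchy_iterate (hs : 1 ≤ s) (hb : IsBMetric b s) (hϑ : ThetaStar ϑ)
    (hF : FcClass F c) (hJ : ARSimulation J s F c ϑ)
    (hcontr : ∀ x y : X, 0 < b (S x) (S y) → c ≤ J (ϑ (b (S x) (S y))) (ϑ (b x y)))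
    (x : X) : BCauchy b fun n => S^[n] x := by
  intro ε hε
  by_contra! hnot
  have hself : ∀ y, b y y = 0 := fun y => (hb.2.1 y y).2 rfl
  have hex : ∀ k, ∃ n m, k ≤ n ∧ ε ≤ b (S^[m + 1] x) (S^[n + 1] x) ∧
      b (S^[m] x) (S^[n + 1] x) < ε := by
    intro k
    have hpair : ∃ n m, k + 1 ≤ n ∧ n ≤ m ∧ ε ≤ b (S^[m] x) (S^[n] x) := by
      obtain ⟨i, hi, j, hj, hij⟩ := hnot (k + 1)
      rcases le_total i j with h | h
      · exact ⟨i, j, hi, h, hb.2.2.1 (S^[i] x) _ ▸ hij⟩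
      · exact ⟨j, i, hj, h, hij⟩
    obtain ⟨n, m, hkn, hnm, hle⟩ := hpair
    obtain ⟨n, rfl⟩ : ∃ n', n = n' + 1 := ⟨n - 1, by omega⟩
    induction m, hnm using Nat.le_induction with
    | base => exact absurd hle (by rw [hself]; exact hε.not_ge)
    | succ m _ ih =>
      by_cases hm : ε ≤ b (S^[m] x) (S^[n + 1] x)
      · exact ih hm
      · exact ⟨n, m, by omega, hle, not_le.1 hm⟩
  choose n m hkn hlow hup using hex
  have hδ : Tendsto (fun k => b (S^[n k] x) (S^[n k + 1] x)) atTop (𝓝 0) :=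
    (tendsto_dist_iterate_succ hs hb hϑ hF hJ hcontr x).comp
      (tendsto_atTop_mono hkn tendsto_id)
  refine not_dist_bounds hs hb hϑ hF hJ hcontr hε (p := fun k => S^[m k] x)
    (q := fun k => S^[n k] x) hδ (fun k => ?_) fun k => ?_
  · simpa only [Function.iterate_succ_apply' S] using hlow k
  · refine (hb.2.2.2 _ (S^[n k + 1] x) _).trans
      (mul_le_mul_of_nonneg_left ?_ (zero_le_one.trans hs))
    rw [hb.2.2.1 (S^[n k + 1] x)]
    exact add_le_add_left (hup k).le _

end Contraction

/-- Every `𝔍_{A_R}`-contraction on a complete b-metric space has a unique fixed point. -/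
theorem fixed_point_of_JAR_contraction {X : Type*} [Nonempty X]
    (b : X → X → ℝ) (s : ℝ) (hs : 1 ≤ s)
    (hb : IsBMetric b s) (hcomp : BComplete b) (S : X → X)
    (J F : ℝ → ℝ → ℝ) (ϑ : ℝ → ℝ) (c : ℝ)
    (hϑ : ThetaStar ϑ) (hF : FcClass F c)
    (hJ : ARSimulation J s F c ϑ)
    (hcontr : ∀ x y : X, 0 < b (S x) (S y) →
      c ≤ J (ϑ (b (S x) (S y))) (ϑ (b x y))) :
    ∃! z : X, S z = z := by
  have hle := map_dist_le hb hϑ hF hJ hcontr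
  obtain ⟨x⟩ := ‹Nonempty X›
  obtain ⟨z, hz⟩ := hcomp _ (bCauchy_iterate hs hb hϑ hF hJ hcontr x)
  have hfix : S z = z := by
    have hlim : Tendsto (fun n => s * (b (S^[n + 1] x) z + b (S^[n] x) z)) atTop (𝓝 0) := by
      simpa using (((tendsto_add_atTop_iff_nat 1).2 hz).add hz).const_mul s
    have h0 : b (S z) z ≤ 0 := by
      refine ge_of_tendsto' hlim fun n => ?_
      refine (hb.2.2.2 _ (S^[n + 1] x) _).trans
        (mul_le_mul_of_nonneg_left ?_ (zero_le_one.trans hs))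
      rw [add_comm, hb.2.2.1 (S z), Function.iterate_succ_apply' S]
      exact add_le_add_right (hle _ _) _
    exact (hb.2.1 _ _).1 (h0.antisymm (hb.1 _ _))
  refine ⟨z, hfix, fun y hy => (hb.2.1 y z).1 ?_⟩
  by_contra hne
  have hpos : 0 < b (S y) (S z) := by
    rw [hy, hfix]
    exact lt_of_le_of_ne (hb.1 y z) (Ne.symm hne)
  have hlt := map_dist_lt hb hϑ hF hJ hcontr hpos
  rw [hy, hfix] at hlt
  exact hlt.false
end

section
/- Let (X, b, s) be a b-metric space with coefficient s ≥ 1 and let S : X → X be a J_{A_R}-contraction whose A_R-simulation function J has its sequence condition with the same coefficient s (with associated F ∈ 𝔉_c having constant c ≥ 1 and ϑ ∈ Θ*), i.e. J(ϑ(b(Sx,Sy)), ϑ(b(x,y))) ≥ c for all x, y ∈ X with b(Sx,Sy) > 0. Let a_0 ∈ X, set a_n = S^n a_0, and assume b(a_n, a_{n+1}) > 0 for all n ≥ 0. Then lim_{n→∞} b(a_n, a_{n+1}) = 0. -/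
open Filter Topology

/-- Two positive sequences with a common positive limit satisfy `SeqCond`. -/
theorem seqCond_of_tendsto {s L : ℝ} (hs : 1 ≤ s) (hL : 0 < L) {u v : ℕ → ℝ}
    (hu : Tendsto u atTop (𝓝 L)) (hv : Tendsto v atTop (𝓝 L)) : SeqCond s u v := by
  have hu' : Tendsto (fun n => (u n : EReal)) atTop (𝓝 (L : EReal)) :=
    (continuous_coe_real_ereal.tendsto L).comp hu
  have hv' : Tendsto (fun n => (v n : EReal)) atTop (𝓝 (L : EReal)) :=
    (continuous_coe_real_ereal.tendsto L).comp hv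
  have h : (0 : EReal) < (L : EReal) ∧ (L : EReal) ≤ (s : EReal) * (L : EReal) ∧
      (s : EReal) * (L : EReal) ≤ ((s ^ 2 : ℝ) : EReal) * (L : EReal) ∧
      ((s ^ 2 : ℝ) : EReal) * (L : EReal) < ⊤ := by
    rw [← EReal.coe_mul, ← EReal.coe_mul]
    refine ⟨EReal.coe_pos.2 hL, EReal.coe_le_coe_iff.2 ?_, EReal.coe_le_coe_iff.2 ?_,
      EReal.coe_lt_top _⟩
    · nlinarith
    · exact mul_le_mul_of_nonneg_right (by nlinarith) hL.le
  unfold SeqCond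
  rw [hu'.liminf_eq, hu'.limsup_eq, hv'.liminf_eq, hv'.limsup_eq]
  exact ⟨h, h⟩

/-- For a `𝔍_{A_R}`-contraction, the Picard distances tend to `0`. -/
theorem picard_distances_tendsto_zero {X : Type*} [Nonempty X]
    (b : X → X → ℝ) (s : ℝ) (hs : 1 ≤ s)
    (hb : IsBMetric b s) (S : X → X)
    (J F : ℝ → ℝ → ℝ) (ϑ : ℝ → ℝ) (c : ℝ)
    (hϑ : ThetaStar ϑ) (hF : FcClass F c)
    (hJ : ARSimulation J s F c ϑ)
    (hcontr : ∀ x y : X, 0 < b (S x) (S y) →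
      c ≤ J (ϑ (b (S x) (S y))) (ϑ (b x y)))
    (a₀ : X) (hpos : ∀ n : ℕ, 0 < b (S^[n] a₀) (S^[n + 1] a₀)) :
    Tendsto (fun n : ℕ => b (S^[n] a₀) (S^[n + 1] a₀)) atTop (𝓝 0) := by
  set d : ℕ → ℝ := fun n => b (S^[n] a₀) (S^[n + 1] a₀) with hd
  obtain ⟨hϑ1, hϑmono, -, -⟩ := hϑ
  obtain ⟨-, hFle, -, -, hFlt, -⟩ := hF
  obtain ⟨hJlt, hJlim⟩ := hJ
  have hdpos : ∀ n, 0 < d n := hpos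
  have hge : ∀ n, c ≤ J (ϑ (d (n + 1))) (ϑ (d n)) := by
    intro n
    have h := hcontr (S^[n] a₀) (S^[n + 1] a₀)
    rw [← Function.iterate_succ_apply' S n, ← Function.iterate_succ_apply' S (n + 1)] at h
    exact h (hpos (n + 1))
  have hlt : ∀ n, J (ϑ (d (n + 1))) (ϑ (d n)) < F (ϑ (d n)) (ϑ (d (n + 1))) := fun n =>
    hJlt _ _ (hϑ1 _ (hdpos _)) (hϑ1 _ (hdpos _))
  have hanti : Antitone d := by
    refine antitone_nat_of_succ_le fun n => ?_
    by_contra! h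
    exact absurd (hFlt _ _ (hϑ1 _ (hdpos _)).le (hϑ1 _ (hdpos _)).le ((hge n).trans_lt (hlt n)))
      (not_lt.2 (hϑmono (hdpos n) (hdpos (n + 1)) h.le))
  have hlim : Tendsto d atTop (𝓝 (⨅ n, d n)) :=
    tendsto_atTop_ciInf hanti ⟨0, by rintro _ ⟨n, rfl⟩; exact (hdpos n).le⟩
  rcases (le_ciInf fun n => (hdpos n).le : 0 ≤ ⨅ n, d n).eq_or_lt with h0 | hL
  · rwa [← h0] at hlim
  · have hbdd : IsBoundedUnder (· ≤ ·) atTop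
        (fun n => J (ϑ (d (n + 1))) (ϑ (d n))) :=
      isBoundedUnder_of ⟨ϑ (d 0), fun n =>
        ((hlt n).le.trans (hFle _ _ (hϑ1 _ (hdpos _)).le (hϑ1 _ (hdpos _)).le)).trans
          (hϑmono (hdpos n) (hdpos 0) (hanti n.zero_le))⟩
    have hsup := hJlim (fun n => d (n + 1)) d (fun n => hdpos (n + 1)) hdpos
      (seqCond_of_tendsto hs hL (hlim.comp (tendsto_add_atTop_nat 1)) hlim)
    exact absurd (le_limsup_of_frequently_le (Frequently.of_forall hge) hbdd) (not_le.2 hsup)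
end

section
/- Let (X, b, s) be a b-metric space with coefficient s ≥ 1 and let S : X → X be a J_{A_R}-contraction whose A_R-simulation function J has its sequence condition with the same coefficient s (with associated F ∈ 𝔉_c having constant c ≥ 1 and ϑ ∈ Θ*), i.e. J(ϑ(b(Sx,Sy)), ϑ(b(x,y))) ≥ c for all x, y ∈ X with b(Sx,Sy) > 0. Let a_0 ∈ X, set a_n = S^n a_0, and assume b(a_n, a_{n+1}) > 0 for all n ≥ 0. Then the Picard sequence (a_n) is Cauchy: for every ε > 0 there exists N such that b(a_n, a_m) < ε for all n, m ≥ N. -/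
open Filter Topology

/-- Two sequences squeezed between `ε > 0` and a null perturbation of `s * ε` satisfy `SeqCond`. -/
theorem seqCond_of_squeeze {s ε : ℝ} (hs : 1 ≤ s) (hε : 0 < ε) {u v e : ℕ → ℝ}
    (hu : ∀ n, ε ≤ u n) (hv : ∀ n, ε ≤ v n) (hu' : ∀ n, u n ≤ s * ε + e n)
    (hv' : ∀ n, v n ≤ s * ε + e n) (he : Tendsto e atTop (𝓝 0)) : SeqCond s u v := by
  have hlim : Tendsto (fun n => ((s * ε + e n : ℝ) : EReal)) atTop (𝓝 ((s * ε : ℝ) : EReal)) := by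
    refine (continuous_coe_real_ereal.tendsto _).comp ?_
    simpa using he.const_add (s * ε)
  have bounds : ∀ w : ℕ → ℝ, (∀ n, ε ≤ w n) → (∀ n, w n ≤ s * ε + e n) →
      (∃ p : ℝ, liminf (fun n => (w n : EReal)) atTop = (p : EReal) ∧ ε ≤ p ∧ p ≤ s * ε) ∧
      ∃ q : ℝ, limsup (fun n => (w n : EReal)) atTop = (q : EReal) ∧ ε ≤ q ∧ q ≤ s * ε := by
    intro w hw hw'
    have h1 : (ε : EReal) ≤ liminf (fun n => (w n : EReal)) atTop :=
      le_liminf_of_le (by isBoundedDefault) (.of_forall fun n => EReal.coe_le_coe_iff.2 (hw n))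
    have h2 : limsup (fun n => (w n : EReal)) atTop ≤ ((s * ε : ℝ) : EReal) := by
      rw [← hlim.limsup_eq]
      exact limsup_le_limsup (.of_forall fun n => EReal.coe_le_coe_iff.2 (hw' n))
    have h3 : liminf (fun n => (w n : EReal)) atTop ≤ limsup (fun n => (w n : EReal)) atTop :=
      liminf_le_limsup
    have key : ∀ z : EReal, (ε : EReal) ≤ z → z ≤ ((s * ε : ℝ) : EReal) →
        ∃ p : ℝ, z = (p : EReal) ∧ ε ≤ p ∧ p ≤ s * ε := by
      intro z hz hz'
      lift z to ℝ using ⟨(hz'.trans_lt (EReal.coe_lt_top _)).ne,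
        ((EReal.bot_lt_coe _).trans_le hz).ne'⟩
      exact ⟨z, rfl, EReal.coe_le_coe_iff.1 hz, EReal.coe_le_coe_iff.1 hz'⟩
    exact ⟨key _ h1 (h3.trans h2), key _ (h1.trans h3) h2⟩
  obtain ⟨⟨p, hp, hp1, hp2⟩, q, hq, hq1, hq2⟩ := bounds u hu hu'
  obtain ⟨⟨r, hr, hr1, hr2⟩, t, ht, ht1, ht2⟩ := bounds v hv hv'
  have hs0 : 0 ≤ s := by linarith
  have mul_bound : ∀ {x y : ℝ}, x ≤ s * ε → ε ≤ y → x ≤ s * y := fun hx hy =>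
    hx.trans (mul_le_mul_of_nonneg_left hy hs0)
  have sq_bound : ∀ {x y : ℝ}, x ≤ s * ε → ε ≤ y → s * x ≤ s ^ 2 * y := fun hx hy => by
    rw [pow_two, mul_assoc]
    exact mul_le_mul_of_nonneg_left (mul_bound hx hy) hs0
  simp only [SeqCond, hp, hq, hr, ht, ← EReal.coe_mul, EReal.coe_le_coe_iff, EReal.coe_pos]
  exact ⟨⟨hε.trans_le hp1, mul_bound hp2 ht1, sq_bound ht2 hp1, EReal.coe_lt_top _⟩,
    hε.trans_le hr1, mul_bound hr2 hq1, sq_bound hq2 hr1, EReal.coe_lt_top _⟩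

/-- A contraction governed by an `A_R`-simulation function strictly decreases distances. -/
theorem dist_map_lt_of_contraction {X : Type*} {b : X → X → ℝ} {s : ℝ} (hb : IsBMetric b s)
    {S : X → X} {J F : ℝ → ℝ → ℝ} {ϑ : ℝ → ℝ} {c : ℝ} (hϑ : ThetaStar ϑ) (hF : FcClass F c)
    (hJ : ARSimulation J s F c ϑ)
    (hcontr : ∀ x y : X, 0 < b (S x) (S y) → c ≤ J (ϑ (b (S x) (S y))) (ϑ (b x y)))
    {x y : X} (h : 0 < b (S x) (S y)) : b (S x) (S y) < b x y := by
  have hxy : 0 < b x y := by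
    refine (hb.1 x y).lt_of_ne' fun h0 => h.ne' ?_
    rw [(hb.2.1 x y).1 h0, hb.2.1]
  have h1 := hϑ.1 _ h
  have h2 := hϑ.1 _ hxy
  have hlt := hF.2.2.2.2.1 _ _ h2.le h1.le ((hcontr x y h).trans_lt (hJ.1 _ _ h1 h2))
  by_contra! hle
  exact (hϑ.2.1 hxy h hle).not_gt hlt

/-- For such a contraction, distances of images cannot stay above `ε > 0` while the original
distances are at most `s * ε` up to a null sequence. -/
theorem false_of_contraction_of_squeeze {X : Type*} {b : X → X → ℝ} {s : ℝ} (hs : 1 ≤ s)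
    (hb : IsBMetric b s) {S : X → X} {J F : ℝ → ℝ → ℝ} {ϑ : ℝ → ℝ} {c : ℝ}
    (hϑ : ThetaStar ϑ) (hF : FcClass F c) (hJ : ARSimulation J s F c ϑ)
    (hcontr : ∀ x y : X, 0 < b (S x) (S y) → c ≤ J (ϑ (b (S x) (S y))) (ϑ (b x y)))
    {ε : ℝ} (hε : 0 < ε) {x y : ℕ → X} {e : ℕ → ℝ} (he : Tendsto e atTop (𝓝 0))
    (hlow : ∀ n, ε ≤ b (S (x n)) (S (y n))) (hup : ∀ n, b (x n) (y n) ≤ s * ε + e n) :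
    False := by
  have hpos : ∀ n, 0 < b (S (x n)) (S (y n)) := fun n => hε.trans_le (hlow n)
  have hlt : ∀ n, b (S (x n)) (S (y n)) < b (x n) (y n) := fun n =>
    dist_map_lt_of_contraction hb hϑ hF hJ hcontr (hpos n)
  have hpos' : ∀ n, 0 < b (x n) (y n) := fun n => (hpos n).trans (hlt n)
  have hseq := hJ.2 _ _ hpos hpos' (seqCond_of_squeeze hs hε hlow
    (fun n => (hlow n).trans (hlt n).le) (fun n => (hlt n).le.trans (hup n)) hup he)
  obtain ⟨B, hB⟩ := he.bddAbove_range
  have hvB : ∀ n, b (x n) (y n) ≤ s * ε + B := fun n =>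
    (hup n).trans (by linarith [hB (Set.mem_range_self n)])
  refine hseq.not_ge (le_limsup_of_frequently_le
    (Frequently.of_forall fun n => hcontr _ _ (hpos n)) ?_)
  refine isBoundedUnder_of ⟨ϑ (s * ε + B), fun n => ?_⟩
  have h1 := hϑ.1 _ (hpos n)
  have h2 := hϑ.1 _ (hpos' n)
  calc _ ≤ F (ϑ (b (x n) (y n))) (ϑ (b (S (x n)) (S (y n)))) := (hJ.1 _ _ h1 h2).le
    _ ≤ ϑ (b (x n) (y n)) := hF.2.1 _ _ h2.le h1.le
    _ ≤ _ := hϑ.2.1 (hpos' n) ((hpos' n).trans_le (hvB n)) (hvB n)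

/-- If a sequence in a b-metric space is not Cauchy, then for some `ε > 0` there are arbitrarily
late indices `k ≤ m` with `b (u k) (u m) < ε ≤ b (u k) (u (m + 1))`. -/
theorem exists_crossing_of_not_bCauchy {X : Type*} {b : X → X → ℝ} {s : ℝ}
    (hb : IsBMetric b s) {u : ℕ → X} (hu : ¬ BCauchy b u) :
    ∃ ε > 0, ∀ N, ∃ k ≥ N, ∃ m ≥ k, b (u k) (u m) < ε ∧ ε ≤ b (u k) (u (m + 1)) := by
  unfold BCauchy at hu
  push Not at hu
  obtain ⟨ε, hε, h⟩ := hu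
  have hself : ∀ k, b (u k) (u k) < ε := fun k => by rwa [(hb.2.1 _ _).2 rfl]
  refine ⟨ε, hε, fun N => ?_⟩
  obtain ⟨k, m, hk, hkm, hle⟩ : ∃ k m, N ≤ k ∧ k ≤ m ∧ ε ≤ b (u k) (u m) := by
    obtain ⟨k, hk, m, hm, hle⟩ := h N
    rcases le_total k m with hkm | hmk
    · exact ⟨k, m, hk, hkm, hle⟩
    · exact ⟨m, k, hm, hmk, hb.2.2.1 (u k) (u m) ▸ hle⟩
  refine ⟨k, hk, ?_⟩
  by_contra! hno
  have hlt : ∀ m ≥ k, b (u k) (u m) < ε := fun m hm => by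
    induction m, hm using Nat.le_induction with
    | base => exact hself k
    | succ m hm ih => exact hno m hm ih
  exact (hlt m hkm).not_ge hle

/-- For a `𝔍_{A_R}`-contraction, the Picard sequence is Cauchy. -/
theorem picard_sequence_cauchy {X : Type*} [Nonempty X]
    (b : X → X → ℝ) (s : ℝ) (hs : 1 ≤ s)
    (hb : IsBMetric b s) (S : X → X)
    (J F : ℝ → ℝ → ℝ) (ϑ : ℝ → ℝ) (c : ℝ)
    (hϑ : ThetaStar ϑ) (hF : FcClass F c)
    (hJ : ARSimulation J s F c ϑ)
    (hcontr : ∀ x y : X, 0 < b (S x) (S y) →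
      c ≤ J (ϑ (b (S x) (S y))) (ϑ (b x y)))
    (a₀ : X) (hpos : ∀ n : ℕ, 0 < b (S^[n] a₀) (S^[n + 1] a₀)) :
    BCauchy b (fun n : ℕ => S^[n] a₀) := by
  have hiter : ∀ n, S^[n + 1] a₀ = S (S^[n] a₀) := fun n => Function.iterate_succ_apply' S n a₀
  set d : ℕ → ℝ := fun n => b (S^[n] a₀) (S^[n + 1] a₀)
  have hd : Antitone d := antitone_nat_of_succ_le fun n => by
    have h := hpos (n + 1)
    rw [hiter (n + 1), hiter n] at h
    have := (dist_map_lt_of_contraction hb hϑ hF hJ hcontr h).le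
    simpa only [d, hiter] using this
  have hbdd : BddBelow (Set.range d) := ⟨0, Set.forall_mem_range.2 fun n => (hpos n).le⟩
  have hlim := tendsto_atTop_ciInf hd hbdd
  set L := ⨅ n, d n
  have hL : L = 0 := by
    by_contra hne
    have hL0 : 0 < L := (le_ciInf fun n => (hpos n).le).lt_of_ne' hne
    refine false_of_contraction_of_squeeze hs hb hϑ hF hJ hcontr hL0
      (x := fun n => S^[n] a₀) (y := fun n => S^[n + 1] a₀) (e := fun n => d n - L)
      (by simpa using hlim.sub_const L) (fun n => ?_) fun n => ?_
    · rw [← hiter, ← hiter]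
      exact ciInf_le hbdd (n + 1)
    · change d n ≤ s * L + (d n - L)
      nlinarith
  rw [hL] at hlim
  by_contra hnot
  obtain ⟨ε, hε, h⟩ := exists_crossing_of_not_bCauchy hb hnot
  choose k hk m hm hlt hle using fun N => h (N + 1)
  refine false_of_contraction_of_squeeze hs hb hϑ hF hJ hcontr hε
    (x := fun N => S^[k N - 1] a₀) (y := fun N => S^[m N] a₀) (e := fun N => s * d N)
    (by simpa using hlim.const_mul s) (fun N => ?_) fun N => ?_
  · have hk1 : k N - 1 + 1 = k N := Nat.sub_add_cancel (by have := hk N; omega)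
    rw [← hiter, ← hiter, hk1]
    exact hle N
  · have hk1 : k N - 1 + 1 = k N := Nat.sub_add_cancel (by have := hk N; omega)
    have hdk : b (S^[k N - 1] a₀) (S^[k N] a₀) ≤ d N := by
      have := hd (show N ≤ k N - 1 by have := hk N; omega)
      simpa only [d, hk1] using this
    refine (hb.2.2.2 _ (S^[k N] a₀) _).trans ?_
    rw [← mul_add]
    exact mul_le_mul_of_nonneg_left (by linarith [hlt N]) (by linarith)
end

section
/- Let (X, b, s) be a b-metric space with coefficient s ≥ 1 and let (a_n) be a sequence in X with lim_{n→∞} b(a_n, a_{n+1}) = 0. If (a_n) is not Cauchy, then there exist ε > 0 and strictly increasing sequences of indices (m_i), (n_i) with i < m_i < n_i for all i such that b(a_{m_i}, a_{n_i}) ≥ ε, b(a_{m_i}, a_{n_i−1}) < ε, and moreover ε ≤ liminf_{i→∞} b(a_{m_i}, a_{n_i}) ≤ limsup_{i→∞} b(a_{m_i}, a_{n_i}) ≤ s·ε and limsup_{i→∞} b(a_{m_i−1}, a_{n_i−1}) ≤ s·ε. -/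
open Filter Topology

/-- A sequence that is not Cauchy has, beyond every index, a pair of terms that are `ε` apart and
such that the second one is the first to be `ε` away from the first one. -/
theorem exists_first_far_pair {X : Type*} {b : X → X → ℝ} {a : ℕ → X}
    (hself : ∀ x, b x x = 0) (hsymm : ∀ x y, b x y = b y x) (hnc : ¬ BCauchy b a) :
    ∃ ε > (0 : ℝ), ∀ N : ℕ, ∃ m n : ℕ, N < m ∧ m < n ∧
      ε ≤ b (a m) (a n) ∧ b (a m) (a (n - 1)) < ε := by
  classical
  unfold BCauchy at hnc
  push Not at hnc
  obtain ⟨ε, hε, h⟩ := hnc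
  refine ⟨ε, hε, fun N => ?_⟩
  have key : ∃ m, N < m ∧ ∃ n, m < n ∧ ε ≤ b (a m) (a n) := by
    obtain ⟨k, hk, l, hl, hkl⟩ := h (N + 1)
    rcases lt_trichotomy k l with hlt | rfl | hlt
    · exact ⟨k, by omega, l, hlt, hkl⟩
    · rw [hself] at hkl
      exact absurd hkl (not_le.mpr hε)
    · exact ⟨l, by omega, k, hlt, by rwa [hsymm]⟩
  obtain ⟨m, hm, hex⟩ := key
  obtain ⟨hlt, hle⟩ := Nat.find_spec hex
  refine ⟨m, Nat.find hex, hm, hlt, hle, ?_⟩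
  rcases (Nat.le_sub_one_of_lt hlt).eq_or_lt with heq | hlt'
  · rwa [← heq, hself]
  · have hmin := Nat.find_min hex (Nat.sub_one_lt_of_lt hlt)
    push Not at hmin
    exact hmin hlt'

/-- A relation that has, beyond every index, a related pair `m < n` has related subsequences. -/
theorem exists_strictMono_pair {P : ℕ → ℕ → Prop}
    (h : ∀ N : ℕ, ∃ m n : ℕ, N < m ∧ m < n ∧ P m n) :
    ∃ m n : ℕ → ℕ, StrictMono m ∧ StrictMono n ∧
      (∀ i, i < m i) ∧ (∀ i, m i < n i) ∧ ∀ i, P (m i) (n i) := by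
  choose f g hf hfg hP using h
  have hstep : ∀ i, g^[i + 1] 0 = g (g^[i] 0) := fun i => Function.iterate_succ_apply' g i 0
  have hmono : StrictMono fun i => g^[i] 0 := strictMono_nat_of_lt_succ fun i => by
    rw [hstep]
    exact (hf _).trans (hfg _)
  refine ⟨fun i => f (g^[i] 0), fun i => g (g^[i] 0), strictMono_nat_of_lt_succ fun i => ?_,
    strictMono_nat_of_lt_succ fun i => ?_, fun i => (hmono.le_apply).trans_lt (hf _),
    fun i => hfg _, fun i => hP _⟩
  · have := hf (g^[i + 1] 0)
    rw [hstep] at this ⊢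
    exact (hfg _).trans this
  · have := (hf (g^[i + 1] 0)).trans (hfg _)
    rwa [hstep] at this ⊢

/-- A nonnegative real sequence dominated by a convergent one is bounded above, and its `limsup`
is at most the limit. -/
theorem limsup_le_of_le_of_tendsto {u v : ℕ → ℝ} {l : ℝ} (hu : ∀ i, 0 ≤ u i)
    (huv : ∀ i, u i ≤ v i) (hv : Tendsto v atTop (𝓝 l)) :
    IsBoundedUnder (· ≤ ·) atTop u ∧ limsup u atTop ≤ l := by
  refine ⟨hv.isBoundedUnder_le.mono_le (Eventually.of_forall huv), ?_⟩
  rw [← hv.limsup_eq]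
  exact limsup_le_limsup (Eventually.of_forall huv)
    (isBoundedUnder_of ⟨0, hu⟩ : IsBoundedUnder (· ≥ ·) atTop u).isCoboundedUnder_le
    hv.isBoundedUnder_le

/-- If consecutive distances tend to `0` but the sequence is not Cauchy, one can extract
the standard pair of subsequences with the usual `liminf`/`limsup` estimates. -/
theorem non_cauchy_subsequence_lemma {X : Type*}
    (b : X → X → ℝ) (s : ℝ) (hs : 1 ≤ s)
    (hb : IsBMetric b s) (a : ℕ → X)
    (hlim : Tendsto (fun n : ℕ => b (a n) (a (n + 1))) atTop (𝓝 0))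
    (hnc : ¬ BCauchy b a) :
    ∃ ε : ℝ, 0 < ε ∧ ∃ m n : ℕ → ℕ,
      StrictMono m ∧ StrictMono n ∧
      (∀ i, i < m i) ∧ (∀ i, m i < n i) ∧
      (∀ i, ε ≤ b (a (m i)) (a (n i))) ∧
      (∀ i, b (a (m i)) (a (n i - 1)) < ε) ∧
      ε ≤ Filter.liminf (fun i => b (a (m i)) (a (n i))) atTop ∧
      Filter.liminf (fun i => b (a (m i)) (a (n i))) atTop ≤
        Filter.limsup (fun i => b (a (m i)) (a (n i))) atTop ∧
      Filter.limsup (fun i => b (a (m i)) (a (n i))) atTop ≤ s * ε ∧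
      Filter.limsup (fun i => b (a (m i - 1)) (a (n i - 1))) atTop ≤ s * ε := by
  obtain ⟨hnonneg, hzero, hsymm, htri⟩ := hb
  have hs0 : 0 ≤ s := zero_le_one.trans hs
  obtain ⟨ε, hε, hpair⟩ := exists_first_far_pair (fun x => (hzero x x).mpr rfl) hsymm hnc
  obtain ⟨m, n, hm, hn, him, hmn, hP⟩ := exists_strictMono_pair hpair
  have hpred : ∀ {k : ℕ → ℕ}, StrictMono k → (∀ i, 0 < k i) →
      Tendsto (fun i => s * (ε + b (a (k i - 1)) (a (k i)))) atTop (𝓝 (s * ε)) := by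
    intro k hk hpos
    have h := hlim.comp ((tendsto_sub_atTop_nat 1).comp hk.tendsto_atTop)
    have h' : Tendsto (fun i => b (a (k i - 1)) (a (k i))) atTop (𝓝 0) :=
      h.congr fun i => by simp [Nat.sub_add_cancel (hpos i)]
    simpa using (h'.const_add ε).const_mul s
  have hmpos : ∀ i, 0 < m i := fun i => (Nat.zero_le i).trans_lt (him i)
  obtain ⟨hbdd, hsup⟩ := limsup_le_of_le_of_tendsto
    (u := fun i => b (a (m i)) (a (n i))) (fun i => hnonneg _ _)
    (fun i => (htri _ (a (n i - 1)) _).trans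
      (mul_le_mul_of_nonneg_left (by linarith [(hP i).2]) hs0))
    (hpred hn fun i => (hmpos i).trans (hmn i))
  obtain ⟨-, hsup'⟩ := limsup_le_of_le_of_tendsto
    (u := fun i => b (a (m i - 1)) (a (n i - 1))) (fun i => hnonneg _ _)
    (fun i => (htri _ (a (m i)) _).trans
      (mul_le_mul_of_nonneg_left (by linarith [(hP i).2]) hs0))
    (hpred hm hmpos)
  exact ⟨ε, hε, m, n, hm, hn, him, hmn, fun i => (hP i).1, fun i => (hP i).2,
    le_liminf_of_le hbdd.isCoboundedUnder_ge (Eventually.of_forall fun i => (hP i).1),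
    liminf_le_limsup hbdd (isBoundedUnder_of ⟨0, fun i => hnonneg _ _⟩), hsup, hsup'⟩
end

section
/- Let (X, b, s) be a b-metric space with coefficient s ≥ 1 (completeness not assumed) and let S : X → X. Suppose there exist an A_R-simulation function J (with associated F ∈ 𝔉_c having constant c ≥ 1 and ϑ ∈ Θ*) such that for all x, y ∈ X with Sx ≠ Sy, J(ϑ(b(Sx,Sy)), ϑ(max{b(x,y), b(x,Sx), b(y,Sy), (b(Sx,y) + b(x,Sy))/(2s)})) ≥ c. Then S has at most one fixed point: if Sz = z and Sw = w then z = w. -/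
open Filter Topology

/-- A generalized `𝔍_{A_R}`-contraction on a b-metric space has at most one fixed point. -/
theorem uniqueness_of_fixed_point_generalized {X : Type*} [Nonempty X]
    (b : X → X → ℝ) (s : ℝ) (hs : 1 ≤ s)
    (hb : IsBMetric b s) (S : X → X)
    (J F : ℝ → ℝ → ℝ) (ϑ : ℝ → ℝ) (c : ℝ)
    (hϑ : ThetaStar ϑ) (hF : FcClass F c)
    (hJ : ∃ s' : ℝ, 1 ≤ s' ∧ ARSimulation J s' F c ϑ)
    (hcontr : ∀ x y : X, S x ≠ S y →
      c ≤ J (ϑ (b (S x) (S y)))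
            (ϑ (max (max (b x y) (b x (S x)))
                (max (b y (S y)) ((b (S x) y + b x (S y)) / (2 * s))))))
    : ∀ z w : X, S z = z → S w = w → z = w := by
  intro z w hz hw
  by_contra hne
  obtain ⟨hnonneg, heq, -⟩ := hb
  obtain ⟨s', -, hlt, -⟩ := hJ
  have hd : 0 < b z w := (hnonneg z w).lt_of_ne fun h => hne ((heq z w).1 h.symm)
  have hhalf : (b z w + b z w) / (2 * s) ≤ b z w := by
    rw [div_le_iff₀ (by linarith)]
    nlinarith
  have h := hcontr z w (by rwa [hz, hw])
  rw [hz, hw, (heq z z).2 rfl, (heq w w).2 rfl, max_eq_left hd.le,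
    max_eq_left (max_le hd.le hhalf)] at h
  have hθ := hϑ.1 _ hd
  exact (h.trans_lt (hlt _ _ hθ hθ)).not_ge (hF.2.2.2.2.2 _ hθ.le)
end
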